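/- Let d ≥ 3 and n ≥ 1 be integers. Let χ : ℝ^{d−1} → [0, 1] be a C^∞ function with χ(x) = 1 whenever ‖x‖₂ ≤ 1 and χ(x) = 0 whenever ‖x‖₂ ≥ 2, and let h > 0 be such that the function ρ(x₁, …, x_{d−1}) = x₁² + ⋯ + x_{d−1}² + h·χ(x)·cos(πn·x₁) is convex on ℝ^{d−1}. Define Σ_0 = {(x; ρ(x)) ∈ ℝ^d : x ∈ ℝ^{d−1}, ‖x‖₂ ≤ 4}. Suppose B_0 ⊆ ℝ^d is a unit ball such that ∂B_0 contains T(Σ_0) for some invertible affine transformation T : ℝ^d → ℝ^d. Then there exists ε > 0 such that for every unit ball B ⊆ ℝ^d with d_H(B_0, B) < ε, the unit distance graph of ‖·‖_B contains a copy of K_{d, 2n}. -/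

import Mathlib

open scoped Pointwise Classical

/-- `B ⊆ ℝ^d` is a unit ball: compact, convex, symmetric about the origin, containing a
neighborhood of 0. -/
def IsUnitBall {d : ℕ} (B : Set (EuclideanSpace ℝ (Fin d))) : Prop :=
  IsCompact B ∧ Convex ℝ B ∧ B = -B ∧ B ∈ nhds (0 : EuclideanSpace ℝ (Fin d))

/-- The unit distance graph of the norm `N` on ℝ^d contains a copy of `K_{a,b}`. -/
def ContainsK {d : ℕ} (N : EuclideanSpace ℝ (Fin d) → ℝ) (a b : ℕ) : Prop :=
  ∃ (u : Fin a → EuclideanSpace ℝ (Fin d)) (v : Fin b → EuclideanSpace ℝ (Fin d)),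
    Function.Injective u ∧ Function.Injective v ∧
    ∀ i j, u i ≠ v j ∧ N (u i - v j) = 1

/-- The point `(x ; y) ∈ ℝ^d` built from `x ∈ ℝ^{d-1}` and a last coordinate `y ∈ ℝ`. -/
noncomputable def toE (d : ℕ) (x : EuclideanSpace ℝ (Fin (d - 1))) (y : ℝ) :
    EuclideanSpace ℝ (Fin d) :=
  (EuclideanSpace.equiv (Fin d) ℝ).symm
    (fun i => if h : (i : ℕ) < d - 1 then x ⟨(i : ℕ), h⟩ else y)

open Metric Set Filter Topology
open scoped NNReal

theorem ConvexOn.approximatesLinearOn_of_close {V : Type*} [NormedAddCommGroup V]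
    [NormedSpace ℝ V] {ρ : V → ℝ} {D : V →L[ℝ] ℝ} {p : V} {U : Set V}
    (hD : HasStrictFDerivAt ρ D p) (hU : U ∈ 𝓝 p) {η : ℝ≥0} (hη : 0 < η) :
    ∃ r > 0, ∀ᶠ δ in 𝓝[>] (0 : ℝ), ∀ g : V → ℝ, ConvexOn ℝ U g →
      (∀ x ∈ U, |g x - ρ x| ≤ δ) → ApproximatesLinearOn g D (closedBall p r) η := by
  obtain ⟨s, hs, hρ⟩ := hD.approximates_deriv_on_nhds (c := η / 2) (Or.inr (by positivity))
  obtain ⟨R, hR, hRs⟩ := Metric.mem_nhds_iff.1 (inter_mem hs hU)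
  have hη' : (0 : ℝ) < η := hη
  set r := R / 4 with hr
  have hr0 : 0 < r := by positivity
  refine ⟨r, hr0, ?_⟩
  have hsmall : ∀ᶠ δ in 𝓝[>] (0 : ℝ), δ < η * r / 4 :=
    nhdsWithin_le_nhds (Iio_mem_nhds (by positivity))
  filter_upwards [hsmall] with δ hδ g hg hgρ
  have key : ∀ y ∈ closedBall p r, ∀ z ∈ closedBall p r,
      g z - g y - D (z - y) ≤ η * ‖z - y‖ := by
    intro y hy z hz
    rcases eq_or_ne z y with rfl | hzy
    · simp
    have ht : 0 < ‖z - y‖ := norm_pos_iff.2 (sub_ne_zero.2 hzy)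
    set t := ‖z - y‖ with htdef
    set w := z + (r / t) • (z - y) with hw
    have hwz : w - z = (r / t) • (z - y) := by simp [hw]
    have hwzn : ‖w - z‖ = r := by
      rw [hwz, norm_smul, Real.norm_eq_abs, abs_of_pos (by positivity), ← htdef]
      field_simp
    rw [mem_closedBall, dist_eq_norm] at hy hz
    have hyR := hRs (show y ∈ ball p R by rw [mem_ball, dist_eq_norm]; linarith)
    have hzR := hRs (show z ∈ ball p R by rw [mem_ball, dist_eq_norm]; linarith)
    have hwR := hRs (show w ∈ ball p R by
      rw [mem_ball, dist_eq_norm]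
      have := norm_add_le (w - z) (z - p)
      rw [sub_add_sub_cancel] at this
      linarith)
    have hconv := hg.2 hyR.2 hwR.2 (show 0 ≤ r / (t + r) by positivity)
      (show 0 ≤ t / (t + r) by positivity) (by field_simp; ring)
    have hcomb : (r / (t + r)) • y + (t / (t + r)) • w = z := by
      rw [hw]
      match_scalars <;> field_simp
      ring
    rw [hcomb, smul_eq_mul, smul_eq_mul] at hconv
    have h1 : (t + r) * g z ≤ r * g y + t * g w := by
      calc (t + r) * g z ≤ (t + r) * (r / (t + r) * g y + t / (t + r) * g w) := by gcongr
        _ = r * g y + t * g w := by field_simp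
    have h2 := hρ w hwR.1 z hzR.1
    rw [hwzn, hwz, map_smul, smul_eq_mul, Real.norm_eq_abs] at h2
    have h3 := (abs_le.1 h2).2
    have h4 := (abs_le.1 (hgρ w hwR.2)).2
    have h5 := (abs_le.1 (hgρ z hzR.2)).1
    push_cast at h3
    have h6 : g w - g z ≤ r / t * D (z - y) + η * r := by linarith
    have h7 : t * (g w - g z) ≤ r * D (z - y) + t * (η * r) := by
      calc t * (g w - g z) ≤ t * (r / t * D (z - y) + η * r) := by gcongr
        _ = _ := by field_simp
    have h8 : r * (g z - g y - D (z - y)) ≤ r * (η * t) := by linarith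
    exact le_of_mul_le_mul_left h8 hr0
  intro x hx y hy
  rw [Real.norm_eq_abs, abs_le]
  have h1 := key x hx y hy
  have h2 := key y hy x hx
  rw [norm_sub_rev, ← neg_sub x y, map_neg] at h1
  constructor <;> linarith

theorem exists_common_value_of_close {V : Type*} [NormedAddCommGroup V] [NormedSpace ℝ V]
    [CompleteSpace V] {ι : Type*} [Fintype ι] {ρ : V → ℝ} {a : ι → V} {c : ι → ℝ} {x₀ : V}
    {U : Set V} {D₀ : V →L[ℝ] ℝ} {D : ι → V →L[ℝ] ℝ} (hD₀ : HasStrictFDerivAt ρ D₀ x₀)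
    (hD : ∀ i, HasStrictFDerivAt ρ (D i) (x₀ - a i)) (hU₀ : U ∈ 𝓝 x₀)
    (hU : ∀ i, U ∈ 𝓝 (x₀ - a i)) (hc : ∀ i, ρ (x₀ - a i) + c i = ρ x₀)
    (hsurj : Function.Surjective (ContinuousLinearMap.pi fun i => D i - D₀))
    {r : ℝ} (hr : 0 < r) :
    ∀ᶠ δ in 𝓝[>] (0 : ℝ), ∀ g : V → ℝ, ConvexOn ℝ U g → (∀ x ∈ U, |g x - ρ x| ≤ δ) →
      ∃ x, dist x x₀ ≤ r ∧ x ∈ U ∧ ∀ i, x - a i ∈ U ∧ g (x - a i) + c i = g x := by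
  set L : V →L[ℝ] ι → ℝ := ContinuousLinearMap.pi fun i => D i - D₀ with hL
  have hrange : L.range = ⊤ := LinearMap.range_eq_top.2 hsurj
  set S := L.nonlinearRightInverseOfSurjective hrange
  have hS : 0 < S.nnnorm := L.nonlinearRightInverseOfSurjective_nnnorm_pos hrange
  set η : ℝ≥0 := S.nnnorm⁻¹ / 4 with hη
  have hη0 : 0 < η := by positivity
  obtain ⟨r₀, hr₀, happ₀⟩ := ConvexOn.approximatesLinearOn_of_close hD₀ hU₀ hη0
  choose R hR happ using fun i => ConvexOn.approximatesLinearOn_of_close (hD i) (hU i) hη0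
  have hs : ∀ᶠ s in 𝓝[>] (0 : ℝ), 0 < s ∧ s ≤ r ∧ s ≤ r₀ ∧ (∀ i, s ≤ R i) ∧
      closedBall x₀ s ⊆ U ∧ ∀ i, closedBall (x₀ - a i) s ⊆ U := by
    have hle : ∀ {b : ℝ}, 0 < b → ∀ᶠ s in 𝓝[>] (0 : ℝ), s ≤ b := fun hb =>
      nhdsWithin_le_nhds (Iic_mem_nhds hb)
    have hsub : ∀ {p : V}, U ∈ 𝓝 p → ∀ᶠ s in 𝓝[>] (0 : ℝ), closedBall p s ⊆ U := fun hp =>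
      nhdsWithin_le_nhds (eventually_closedBall_subset hp)
    filter_upwards [self_mem_nhdsWithin, hle hr, hle hr₀, eventually_all.2 fun i => hle (hR i),
      hsub hU₀, eventually_all.2 fun i => hsub (hU i)] with s h1 h2 h3 h4 h5 h6
    exact ⟨h1, h2, h3, h4, h5, h6⟩
  obtain ⟨s, hs0, hsr, hsr₀, hsR, hsU₀, hsU⟩ := hs.exists
  have hsmall : ∀ᶠ δ in 𝓝[>] (0 : ℝ), δ < η * s :=
    nhdsWithin_le_nhds (Iio_mem_nhds (by positivity))
  filter_upwards [hsmall, happ₀, eventually_all.2 happ, self_mem_nhdsWithin]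
    with δ hδ h₀ h₁ hδ0 g hg hgρ
  have hδ0 : 0 < δ := hδ0
  set F : V → ι → ℝ := fun x i => g (x - a i) + c i - g x with hF
  have hFL : ApproximatesLinearOn F L (closedBall x₀ s) (2 * η) := by
    intro x hx y hy
    rw [pi_norm_le_iff_of_nonneg (by positivity)]
    intro i
    have hsh : ∀ {z}, z ∈ closedBall x₀ s → z - a i ∈ closedBall (x₀ - a i) (R i) := by
      intro z hz
      rw [mem_closedBall, dist_sub_right]
      exact (mem_closedBall.1 hz).trans (hsR i)
    have e1 := h₁ i g hg hgρ _ (hsh hx) _ (hsh hy)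
    have e2 := h₀ g hg hgρ _ (closedBall_subset_closedBall hsr₀ hx) _
      (closedBall_subset_closedBall hsr₀ hy)
    rw [sub_sub_sub_cancel_right] at e1
    calc ‖(F x - F y - L (x - y)) i‖
        = ‖(g (x - a i) - g (y - a i) - D i (x - y)) - (g x - g y - D₀ (x - y))‖ := by
          congr 1
          simp only [hF, hL, Pi.sub_apply, ContinuousLinearMap.coe_pi',
            sub_apply]
          ring
      _ ≤ η * ‖x - y‖ + η * ‖x - y‖ := (norm_sub_le _ _).trans (add_le_add e1 e2)
      _ = _ := by push_cast; ring
  have hsurjOn := hFL.surjOn_closedBall_of_nonlinearRightInverse S hs0.le subset_rfl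
  have h0mem : (0 : ι → ℝ) ∈ closedBall (F x₀)
      (((S.nnnorm : ℝ)⁻¹ - (2 * η : ℝ≥0)) * s) := by
    rw [mem_closedBall, dist_zero_left, pi_norm_le_iff_of_nonneg]
    · intro i
      have e1 := abs_le.1 (hgρ _ (hsU i (mem_closedBall_self hs0.le)))
      have e2 := abs_le.1 (hgρ _ (hsU₀ (mem_closedBall_self hs0.le)))
      have e3 := hc i
      have e4 : ((S.nnnorm : ℝ)⁻¹ - (2 * η : ℝ≥0)) * s = 2 * (η * s) := by
        rw [hη]; push_cast; ring
      rw [e4, Real.norm_eq_abs, abs_le]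
      simp only [hF]
      constructor <;> linarith
    · have : ((S.nnnorm : ℝ)⁻¹ - (2 * η : ℝ≥0)) = 2 * η := by
        rw [hη]; push_cast; ring
      rw [this]; positivity
  obtain ⟨x, hx, hx0⟩ := hsurjOn h0mem
  refine ⟨x, (mem_closedBall.1 hx).trans hsr, hsU₀ hx, fun i => ⟨hsU i ?_, ?_⟩⟩
  · rw [mem_closedBall, dist_sub_right]
    exact hx
  · have := congrFun hx0 i
    simp only [hF, Pi.zero_apply] at this
    linarith

theorem IsCompact.exists_subset_of_hausdorffDist_lt {E : Type*} [NormedAddCommGroup E]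
    [InnerProductSpace ℝ E] {K B₀ : Set E} (hK : IsCompact K) (hB₀ : Bornology.IsBounded B₀)
    (hKB : K ⊆ interior B₀) :
    ∃ ε > 0, ∀ B : Set E, IsCompact B → B.Nonempty → Convex ℝ B →
      hausdorffDist B₀ B < ε → K ⊆ B := by
  obtain ⟨δ, hδ, hsub⟩ := hK.exists_cthickening_subset_open isOpen_interior hKB
  refine ⟨δ, hδ, fun B hB hBne hBconv hdist x hx => ?_⟩
  by_contra hxB
  obtain ⟨q, hq, hqmin⟩ := exists_norm_eq_iInf_of_complete_convex hBne hB.isComplete hBconv x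
  have hproj := (norm_eq_iInf_iff_real_inner_le_zero hBconv hq).1 hqmin
  have hpos : 0 < ‖x - q‖ := norm_pos_iff.2 (sub_ne_zero.2 fun h => hxB (h ▸ hq))
  set w := x + (δ / ‖x - q‖) • (x - q) with hw
  have hwB : w ∈ B₀ := by
    refine interior_subset (hsub (mem_cthickening_of_dist_le w x δ K hx ?_))
    rw [hw, dist_self_add_left, norm_smul, Real.norm_eq_abs, abs_of_pos (by positivity)]
    field_simp
    rfl
  obtain ⟨b, hb, hwb⟩ := exists_dist_lt_of_hausdorffDist_lt hwB hdist
    (hausdorffEDist_ne_top_of_nonempty_of_bounded ⟨w, hwB⟩ hBne hB₀ hB.isBounded)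
  have h1 := hproj b hb
  have h2 : inner ℝ (x - q) (w - b) =
      ‖x - q‖ ^ 2 + δ * ‖x - q‖ - inner ℝ (x - q) (b - q) := by
    have : w - b = (x - q) + (δ / ‖x - q‖) • (x - q) - (b - q) := by rw [hw]; abel
    rw [this, inner_sub_right, inner_add_right, inner_smul_right, real_inner_self_eq_norm_sq]
    field_simp
  have h3 := real_inner_le_norm (x - q) (w - b)
  rw [dist_eq_norm] at hwb
  nlinarith

theorem IsCompact.exists_disjoint_of_hausdorffDist_lt {E : Type*} [PseudoMetricSpace E]
    {K B₀ : Set E} (hK : IsCompact K) (hB₀ : IsCompact B₀) (hB₀ne : B₀.Nonempty)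
    (hB₀c : IsClosed B₀) (hKB : Disjoint K B₀) :
    ∃ ε > 0, ∀ B : Set E, IsCompact B → hausdorffDist B₀ B < ε → Disjoint K B := by
  obtain ⟨δ, hδ, hdisj⟩ := hKB.exists_thickenings hK hB₀c
  refine ⟨δ, hδ, fun B hB hdist => Set.disjoint_left.2 fun x hxK hxB => ?_⟩
  obtain ⟨b, hb, hxb⟩ := exists_dist_lt_of_hausdorffDist_lt' hxB hdist
    (hausdorffEDist_ne_top_of_nonempty_of_bounded hB₀ne ⟨x, hxB⟩ hB₀.isBounded hB.isBounded)
  refine Set.disjoint_left.1 hdisj (self_subset_thickening hδ K hxK) ?_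
  exact mem_thickening_iff.2 ⟨b, hb, by rwa [dist_comm]⟩

theorem exists_norm_eq_and_eq_smul {V : Type*} [NormedAddCommGroup V] [NormedSpace ℝ V]
    [Nontrivial V] {R : ℝ} (hR : 0 < R) {x : V} (hx : ‖x‖ ≤ R) :
    ∃ w : V, ‖w‖ = R ∧ ∃ s ∈ Icc (0 : ℝ) 1, x = s • w := by
  rcases eq_or_ne x 0 with rfl | hx0
  · obtain ⟨w, hw⟩ := exists_norm_eq V hR.le
    exact ⟨w, hw, 0, by simp, by simp⟩
  · have hpos : 0 < ‖x‖ := norm_pos_iff.2 hx0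
    refine ⟨(R / ‖x‖) • x, ?_, ‖x‖ / R, ⟨by positivity, (div_le_one hR).2 hx⟩, ?_⟩
    · rw [norm_smul, Real.norm_eq_abs, abs_of_pos (by positivity)]
      field_simp
    · rw [smul_smul]
      field_simp
      simp

theorem Convex.mem_interior_of_graph_subset {V : Type*} [NormedAddCommGroup V]
    [NormedSpace ℝ V] [Nontrivial V] {C : Set (V × ℝ)} (hC : Convex ℝ C) {ρ : V → ℝ}
    (hρ : Continuous ρ) {R M : ℝ} (hR : 0 < R) (hgraph : ∀ x, ‖x‖ ≤ R → (x, ρ x) ∈ C)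
    (hM : ∀ x, ‖x‖ = R → ρ x = M) {x : V} {y : ℝ} (hx : ‖x‖ < R) (hxy : ρ x < y)
    (hy : y < M) : (x, y) ∈ interior C := by
  have htop : ∀ x : V, ‖x‖ < R → (x, M) ∈ C := by
    intro x hx
    obtain ⟨w, hw, s, hs, hxw⟩ := exists_norm_eq_and_eq_smul hR hx.le
    have h1 := hgraph w hw.le
    have h2 := hgraph (-w) (by rw [norm_neg]; exact hw.le)
    rw [hM w hw] at h1
    rw [hM (-w) (by rwa [norm_neg])] at h2
    have h3 := hC h1 h2 (a := (1 + s) / 2) (b := (1 - s) / 2) (by linarith [hs.1])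
      (by linarith [hs.2]) (by ring)
    convert h3 using 1
    ext1
    · simp only [Prod.fst_add, Prod.smul_fst, hxw]
      module
    · simp only [Prod.snd_add, Prod.smul_snd, smul_eq_mul]
      ring
  have hopen : IsOpen {p : V × ℝ | ‖p.1‖ < R ∧ ρ p.1 < p.2 ∧ p.2 < M} :=
    (isOpen_lt continuous_fst.norm continuous_const).inter
      ((isOpen_lt (hρ.comp continuous_fst) continuous_snd).inter
        (isOpen_lt continuous_snd continuous_const))
  refine interior_maximal ?_ hopen ⟨hx, hxy, hy⟩
  rintro ⟨x, y⟩ ⟨hx, hxy, hy⟩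
  simp only at hx hxy hy
  have hpos : 0 < M - ρ x := by linarith
  have h3 := hC (hgraph x hx.le) (htop x hx) (a := (M - y) / (M - ρ x))
    (b := (y - ρ x) / (M - ρ x)) (div_nonneg (by linarith) hpos.le)
    (div_nonneg (by linarith) hpos.le) (by field_simp; ring)
  convert h3 using 1
  ext1
  · simp only [Prod.fst_add, Prod.smul_fst, ← add_smul]
    rw [← add_div, sub_add_sub_cancel, div_self hpos.ne', one_smul]
  · simp only [Prod.snd_add, Prod.smul_snd, smul_eq_mul]
    field_simp
    ring

theorem Convex.notMem_of_mem_frontier_of_mem_interior {V : Type*} [NormedAddCommGroup V]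
    [NormedSpace ℝ V] {C : Set (V × ℝ)} (hC : Convex ℝ C) {x : V} {y z t : ℝ}
    (hz : (x, z) ∈ frontier C) (ht : (x, t) ∈ interior C) (hyz : y < z) (hzt : z < t) :
    (x, y) ∉ C := by
  intro hy
  refine hz.2 (hC.openSegment_interior_self_subset_interior ht hy ?_)
  have hpos : 0 < t - y := by linarith
  refine ⟨(z - y) / (t - y), (t - z) / (t - y), div_pos (by linarith) hpos,
    div_pos (by linarith) hpos, by field_simp; ring, ?_⟩
  ext1
  · simp only [Prod.fst_add, Prod.smul_fst, ← add_smul]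
    rw [← add_div, add_comm, sub_add_sub_cancel, div_self hpos.ne', one_smul]
  · simp only [Prod.snd_add, Prod.smul_snd, smul_eq_mul]
    field_simp
    ring

theorem Convex.exists_convexOn_graph_subset_frontier {V : Type*} [NormedAddCommGroup V]
    [NormedSpace ℝ V] {C : Set (V × ℝ)} (hCc : IsCompact C) (hC : Convex ℝ C) {U : Set V}
    (hU : Convex ℝ U) {ρ : V → ℝ} {δ : ℝ} (hδ : 0 ≤ δ) (hup : ∀ x ∈ U, (x, ρ x + δ) ∈ C)
    (hdown : ∀ x ∈ U, (x, ρ x - δ) ∉ C) :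
    ∃ g : V → ℝ, ConvexOn ℝ U g ∧ (∀ x ∈ U, |g x - ρ x| ≤ δ) ∧
      ∀ x ∈ U, (x, g x) ∈ frontier C := by
  have hleast : ∀ x, ∃ y, x ∈ U → IsLeast {y | (x, y) ∈ C} y := by
    intro x
    by_cases hx : x ∈ U
    · have hfib : {y | (x, y) ∈ C} = Prod.snd '' (C ∩ Prod.fst ⁻¹' {x}) := by
        ext y; simp
      have hcomp : IsCompact {y | (x, y) ∈ C} := by
        rw [hfib]
        exact (hCc.inter_right (isClosed_singleton.preimage continuous_fst)).image continuous_snd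
      obtain ⟨y, hy⟩ := hcomp.exists_isLeast ⟨_, hup x hx⟩
      exact ⟨y, fun _ => hy⟩
    · exact ⟨0, fun h => absurd h hx⟩
  choose g hg using hleast
  refine ⟨g, ⟨hU, ?_⟩, fun x hx => ?_, fun x hx => ⟨subset_closure (hg x hx).1, fun hinterior => ?_⟩⟩
  · intro x hx y hy a b ha hb hab
    exact (hg _ (hU hx hy ha hb hab)).2 (hC (hg x hx).1 (hg y hy).1 ha hb hab)
  · have hle := (hg x hx).2 (hup x hx)
    refine abs_le.2 ⟨?_, by linarith⟩
    by_contra! hlt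
    refine hdown x hx ?_
    have hconv : Convex ℝ {y | (x, y) ∈ C} := by
      intro y hy z hz a b ha hb hab
      have := hC hy hz ha hb hab
      rwa [Prod.smul_mk, Prod.smul_mk, Prod.mk_add_mk, ← add_smul, hab, one_smul] at this
    exact hconv.ordConnected.out (hg x hx).1 (hup x hx) ⟨by linarith, by linarith⟩
  · have hcont : ContinuousAt (fun y : ℝ => (x, y)) (g x) := by fun_prop
    have hnear := hcont.preimage_mem_nhds (mem_interior_iff_mem_nhds.1 hinterior)
    obtain ⟨y, hy, hyC⟩ := ((frequently_lt_nhds (g x)).and_eventually hnear).exists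
    exact absurd ((hg x hx).2 hyC) (not_le.2 hy)

/-- The vectors `5/2 • e_i` for `i ≠ i₀`, together with `-5/2 • e_{i₁}` in place of index `i₀`. -/
noncomputable def translationVector {m : ℕ} (i₀ i₁ i : Fin m) : EuclideanSpace ℝ (Fin m) :=
  if i = i₀ then EuclideanSpace.single i₁ (-(5 / 2)) else EuclideanSpace.single i (5 / 2)

theorem inner_translationVector {m : ℕ} (i₀ i₁ i : Fin m) (w : EuclideanSpace ℝ (Fin m)) :
    inner ℝ (translationVector i₀ i₁ i) w =
      if i = i₀ then -(5 / 2) * w i₁ else 5 / 2 * w i := by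
  unfold translationVector
  split_ifs <;> simp [EuclideanSpace.inner_single_left]

theorem norm_translationVector {m : ℕ} (i₀ i₁ i : Fin m) :
    ‖translationVector i₀ i₁ i‖ = 5 / 2 := by
  unfold translationVector
  split_ifs <;> simp

theorem translationVector_ne_zero {m : ℕ} (i₀ i₁ i : Fin m) :
    translationVector i₀ i₁ i ≠ 0 := by
  rw [← norm_ne_zero_iff, norm_translationVector]
  norm_num

theorem translationVector_injective {m : ℕ} (i₀ i₁ : Fin m) :
    Function.Injective (translationVector i₀ i₁) := by
  intro i k hik
  have key : ∀ {i k : Fin m}, k ≠ i₀ → translationVector i₀ i₁ i = translationVector i₀ i₁ k →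
      i = k := by
    intro i k hk hik
    by_contra hne
    have h1 : inner ℝ (translationVector i₀ i₁ i) (EuclideanSpace.single k 1) ≤ (0 : ℝ) := by
      rw [inner_translationVector]
      split_ifs
      · by_cases hk1 : i₁ = k <;> norm_num [hk1]
      · simp [hne]
    rw [hik, inner_translationVector, if_neg hk] at h1
    norm_num at h1
  by_cases hk : k = i₀
  · by_cases hi : i = i₀
    · rw [hi, hk]
    · exact (key hi hik.symm).symm
  · exact key hk hik

theorem eventually_exists_common_value {m n : ℕ} (hn : 1 ≤ n) {i₀ i₁ : Fin m} (hi : i₁ ≠ i₀)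
    {h : ℝ} (hh : 0 < h) {ρ : EuclideanSpace ℝ (Fin m) → ℝ}
    (hin : ∀ x, ‖x‖ ≤ 1 → ρ x = ‖x‖ ^ 2 + h * Real.cos (Real.pi * n * x i₀))
    (hout : ∀ x, 2 ≤ ‖x‖ → ρ x = ‖x‖ ^ 2) {t r : ℝ} (ht : |t| < 1)
    (htcos : Real.cos (Real.pi * n * t) = 0) (hr : 0 < r) :
    ∀ᶠ δ in 𝓝[>] (0 : ℝ), ∀ g : EuclideanSpace ℝ (Fin m) → ℝ,
      ConvexOn ℝ (ball 0 3) g → (∀ x ∈ ball 0 3, |g x - ρ x| ≤ δ) →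
      ∃ x, dist x (EuclideanSpace.single i₀ t) ≤ r ∧ x ∈ ball 0 3 ∧
        ∀ i, x - translationVector i₀ i₁ i ∈ ball 0 3 ∧
          g (x - translationVector i₀ i₁ i) + -(25 / 4) = g x := by
  set x₀ : EuclideanSpace ℝ (Fin m) := EuclideanSpace.single i₀ t with hx₀
  set a := translationVector i₀ i₁ with ha
  set s := Real.sin (Real.pi * n * t) with hs
  have hs0 : s ≠ 0 := by
    intro h0
    have := Real.sin_sq_add_cos_sq (Real.pi * n * t)
    rw [htcos, ← hs, h0] at this
    norm_num at this
  have hx₀n : ‖x₀‖ < 1 := by simpa [hx₀] using ht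
  have hx₀sq : ‖x₀‖ ^ 2 < 1 := by nlinarith [norm_nonneg x₀]
  have hnorm : ∀ i, ‖x₀ - a i‖ ^ 2 = ‖x₀‖ ^ 2 + 25 / 4 := by
    intro i
    have : inner ℝ x₀ (a i) = (0 : ℝ) := by
      rw [real_inner_comm, ha, inner_translationVector]
      split_ifs with h0
      · simp [hx₀, hi]
      · simp [hx₀, h0]
    rw [norm_sub_sq_real, this, ha, norm_translationVector]
    norm_num
  have hgt : ∀ i, 2 < ‖x₀ - a i‖ := fun i => by
    nlinarith [hnorm i, norm_nonneg (x₀ - a i), sq_nonneg ‖x₀‖]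
  have hlt : ∀ i, ‖x₀ - a i‖ < 3 := fun i => by
    nlinarith [hnorm i, norm_nonneg (x₀ - a i)]
  have hnbhd : ∀ {x : EuclideanSpace ℝ (Fin m)}, ‖x‖ < 3 → ball 0 3 ∈ 𝓝 x := fun hx =>
    isOpen_ball.mem_nhds (by simpa using hx)
  have hD₀ : HasStrictFDerivAt ρ (2 • innerSL ℝ x₀ + h • ((-s) • ((Real.pi * n) •
      (EuclideanSpace.proj i₀ : EuclideanSpace ℝ (Fin m) →L[ℝ] ℝ)))) x₀ := by
    have hlin : HasStrictFDerivAt (fun x : EuclideanSpace ℝ (Fin m) => Real.pi * n * x i₀)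
        ((Real.pi * n) • (EuclideanSpace.proj i₀ : EuclideanSpace ℝ (Fin m) →L[ℝ] ℝ)) x₀ :=
      (EuclideanSpace.proj i₀ : EuclideanSpace ℝ (Fin m) →L[ℝ] ℝ).hasStrictFDerivAt.const_mul _
    have hval : x₀ i₀ = t := by simp [hx₀]
    have hcos := hlin.cos
    rw [hval] at hcos
    refine ((hasStrictFDerivAt_norm_sq x₀).add (hcos.const_mul h)).congr_of_eventuallyEq ?_
    filter_upwards [isOpen_ball.mem_nhds (show x₀ ∈ ball (0 : EuclideanSpace ℝ (Fin m)) 1 by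
      simpa using hx₀n)] with x hx
    rw [hin x (by simpa using (mem_ball_zero_iff.1 hx).le)]
    rfl
  have hD : ∀ i, HasStrictFDerivAt ρ (2 • innerSL ℝ (x₀ - a i)) (x₀ - a i) := by
    intro i
    refine (hasStrictFDerivAt_norm_sq (x₀ - a i)).congr_of_eventuallyEq ?_
    filter_upwards [(isOpen_lt continuous_const continuous_norm).mem_nhds (hgt i)] with x hx
    rw [hout x (le_of_lt hx)]
  refine exists_common_value_of_close (c := fun _ => -(25 / 4)) hD₀ hD
    (hnbhd (by linarith)) (fun i => hnbhd (hlt i)) (fun i => ?_) ?_ hr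
  · rw [hout _ (hgt i).le, hin _ hx₀n.le, hnorm i]
    simp [hx₀, htcos]
  · refine (LinearMap.injective_iff_surjective_of_finrank_eq_finrank (by simp)
      (f := (ContinuousLinearMap.pi _ : EuclideanSpace ℝ (Fin m) →L[ℝ] Fin m → ℝ).toLinearMap)).1 ?_
    rw [injective_iff_map_eq_zero]
    intro w hw
    have hκ : h * (s * (Real.pi * n)) ≠ 0 := by
      have : (n : ℝ) ≠ 0 := by positivity
      have := Real.pi_ne_zero
      positivity
    have hcoord : ∀ i, -2 * inner ℝ (a i) w + h * (s * (Real.pi * n)) * w i₀ = 0 := by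
      intro i
      have := congrFun hw i
      simp at this
      linarith
    simp only [ha, inner_translationVector] at hcoord
    have e0 := hcoord i₀
    have e1 := hcoord i₁
    rw [if_pos rfl] at e0
    rw [if_neg hi] at e1
    have hw0 : w i₀ = 0 := by
      have : h * (s * (Real.pi * n)) * w i₀ = 0 := by linarith
      exact (mul_eq_zero.1 this).resolve_left hκ
    ext i
    by_cases h0 : i = i₀
    · simpa [h0] using hw0
    · have := hcoord i
      rw [if_neg h0, hw0] at this
      simp only [PiLp.zero_apply]
      linarith

theorem ConvexOn.le_of_sphere {V : Type*} [NormedAddCommGroup V] [NormedSpace ℝ V]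
    [Nontrivial V] {ρ : V → ℝ} (hρ : ConvexOn ℝ univ ρ) {R M : ℝ} (hR : 0 < R)
    (hM : ∀ x, ‖x‖ = R → ρ x = M) {x : V} (hx : ‖x‖ ≤ R) : ρ x ≤ M := by
  obtain ⟨w, hw, s, hs, hxw⟩ := exists_norm_eq_and_eq_smul hR hx
  have h1 := hρ.2 (mem_univ w) (mem_univ (-w)) (show 0 ≤ (1 + s) / 2 by linarith [hs.1])
    (show 0 ≤ (1 - s) / 2 by linarith [hs.2]) (by ring)
  have h2 : ((1 + s) / 2) • w + ((1 - s) / 2) • -w = x := by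
    rw [hxw]
    module
  rw [h2, hM w hw, hM (-w) (by rwa [norm_neg]), smul_eq_mul, smul_eq_mul] at h1
  linarith

theorem exists_close_graph_subset_frontier {V E : Type*} [NormedAddCommGroup V]
    [NormedSpace ℝ V] [Nontrivial V] [FiniteDimensional ℝ V] [NormedAddCommGroup E]
    [InnerProductSpace ℝ E] [FiniteDimensional ℝ E] (Φ : (V × ℝ) ≃ᵃ[ℝ] E) {B₀ : Set E}
    (hB₀ : IsCompact B₀) (hB₀conv : Convex ℝ B₀) {ρ : V → ℝ} (hρc : Continuous ρ)
    (hρ : ConvexOn ℝ univ ρ) (hout : ∀ x, 2 ≤ ‖x‖ → ρ x = ‖x‖ ^ 2)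
    (hgraph : ∀ x, ‖x‖ ≤ 4 → Φ (x, ρ x) ∈ frontier B₀) {δ : ℝ} (hδ : 0 < δ) (hδ1 : δ < 1) :
    ∃ ε > 0, ∀ B : Set E, IsCompact B → B.Nonempty → Convex ℝ B → hausdorffDist B₀ B < ε →
      ∃ g : V → ℝ, ConvexOn ℝ (ball 0 3) g ∧ (∀ x ∈ ball 0 3, |g x - ρ x| ≤ δ) ∧
        ∀ x ∈ ball 0 3, Φ (x, g x) ∈ frontier B := by
  set Ψ : (V × ℝ) ≃ₜ E :=
    { Φ.toEquiv with
      continuous_toFun := Φ.continuous_of_finiteDimensional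
      continuous_invFun := Φ.symm.continuous_of_finiteDimensional }
  have hΨ : ∀ p, Φ p = Ψ p := fun _ => rfl
  have hconv : ∀ {B : Set E}, Convex ℝ B → Convex ℝ (Ψ ⁻¹' B) := fun hB =>
    hB.affine_preimage Φ.toAffineMap
  have hle : ∀ x : V, ‖x‖ ≤ 3 → ρ x ≤ 9 := fun x hx =>
    hρ.le_of_sphere (by norm_num) (fun y hy => by rw [hout y (by linarith), hy]; norm_num) hx
  have hfr : ∀ x, ‖x‖ ≤ 4 → (x, ρ x) ∈ frontier (Ψ ⁻¹' B₀) := fun x hx => by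
    rw [← Ψ.preimage_frontier]
    exact hgraph x hx
  have hinterior : ∀ x y, ‖x‖ ≤ 3 → ρ x < y → y < 16 → (x, y) ∈ interior (Ψ ⁻¹' B₀) :=
    fun x y hx hxy hy => (hconv hB₀conv).mem_interior_of_graph_subset hρc (R := 4) (by norm_num)
      (fun x hx => (hB₀.isClosed.preimage Ψ.continuous).frontier_subset (hfr x hx))
      (fun z hz => by rw [hout z (by linarith), hz]; norm_num) (by linarith) hxy hy
  have hup : Ψ '' ((fun x => (x, ρ x + δ)) '' closedBall 0 3) ⊆ interior B₀ := by
    rintro _ ⟨_, ⟨x, hx, rfl⟩, rfl⟩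
    rw [mem_closedBall_zero_iff] at hx
    have := hinterior x (ρ x + δ) hx (by linarith) (by linarith [hle x hx])
    rwa [← Ψ.preimage_interior] at this
  have hdown : Disjoint (Ψ '' ((fun x => (x, ρ x - δ)) '' closedBall 0 3)) B₀ := by
    rw [Set.disjoint_left]
    rintro _ ⟨_, ⟨x, hx, rfl⟩, rfl⟩
    rw [mem_closedBall_zero_iff] at hx
    exact (hconv hB₀conv).notMem_of_mem_frontier_of_mem_interior (hfr x (by linarith))
      (hinterior x 15 hx (by linarith [hle x hx]) (by norm_num)) (by linarith)
      (by linarith [hle x hx])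
  have hcomp : ∀ f : V → V × ℝ, Continuous f → IsCompact (Ψ '' (f '' closedBall 0 3)) :=
    fun f hf => ((isCompact_closedBall 0 3).image hf).image Ψ.continuous
  have hB₀ne : B₀.Nonempty :=
    ⟨_, hB₀.isClosed.frontier_subset (hgraph 0 (by simp))⟩
  obtain ⟨ε₁, hε₁, h₁⟩ := (hcomp _ (by fun_prop)).exists_subset_of_hausdorffDist_lt
    hB₀.isBounded hup
  obtain ⟨ε₂, hε₂, h₂⟩ := (hcomp _ (by fun_prop)).exists_disjoint_of_hausdorffDist_lt
    hB₀ hB₀ne hB₀.isClosed hdown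
  refine ⟨min ε₁ ε₂, lt_min hε₁ hε₂, fun B hB hBne hBconv hdist => ?_⟩
  have hsub := h₁ B hB hBne hBconv (hdist.trans_le (min_le_left _ _))
  have hdis := h₂ B hB (hdist.trans_le (min_le_right _ _))
  obtain ⟨g, hg, hgρ, hgB⟩ := Convex.exists_convexOn_graph_subset_frontier (ρ := ρ)
    (Ψ.isCompact_preimage.2 hB) (hconv hBconv) (convex_ball (0 : V) 3) hδ.le
    (fun x hx => hsub (mem_image_of_mem _ (mem_image_of_mem _ (ball_subset_closedBall hx))))
    (fun x hx => Set.disjoint_left.1 hdis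
      (mem_image_of_mem _ (mem_image_of_mem _ (ball_subset_closedBall hx))))
  refine ⟨g, hg, hgρ, fun x hx => ?_⟩
  have := hgB x hx
  rwa [← Ψ.preimage_frontier] at this

/-- The map `(x, y) ↦ (x ; y)` as a linear equivalence. -/
noncomputable def toELinearEquiv (d : ℕ) (hd : 0 < d) :
    (EuclideanSpace ℝ (Fin (d - 1)) × ℝ) ≃ₗ[ℝ] EuclideanSpace ℝ (Fin d) :=
  LinearMap.linearEquivOfInjective
    { toFun := fun p => toE d p.1 p.2
      map_add' := fun p q => by
        ext i
        by_cases hi : (i : ℕ) < d - 1 <;> simp [toE, hi]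
      map_smul' := fun c p => by
        ext i
        by_cases hi : (i : ℕ) < d - 1 <;> simp [toE, hi] }
    (by
      rintro ⟨x, y⟩ ⟨x', y'⟩ hxy
      have hcoord : ∀ i : Fin d, toE d x y i = toE d x' y' i := fun i => congrArg (· i) hxy
      ext1
      · ext i
        simpa [toE] using hcoord ⟨i, by omega⟩
      · simpa [toE] using hcoord ⟨d - 1, by omega⟩)
    (by simp; omega)

theorem containsK_gauge_of_common_value {d b : ℕ} {V : Type*} [AddCommGroup V] [Module ℝ V]
    (Φ : (V × ℝ) ≃ᵃ[ℝ] EuclideanSpace ℝ (Fin d)) {B : Set (EuclideanSpace ℝ (Fin d))}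
    (hB : IsUnitBall B) {g : V → ℝ} {a : Fin d → V} {c : Fin d → ℝ} {x : Fin b → V}
    (ha : Function.Injective a) (hx : Function.Injective x) {s : Fin b → ℝ}
    (hs : ∀ i j, g (x j - a i) + c i = s j)
    (hfr : ∀ i j, Φ (x j - a i, g (x j - a i)) ∈ frontier B) :
    ContainsK (gauge B) d b := by
  have hgauge : ∀ i j, gauge B (-(Φ.linear (a i, c i)) - -Φ (x j, s j)) = 1 := by
    intro i j
    rw [gauge_eq_one_iff_mem_frontier hB.2.1 hB.2.2.2]
    convert hfr i j using 1
    have : (x j - a i, g (x j - a i)) = -(a i, c i) +ᵥ (x j, s j) := by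
      ext1
      · simp only [vadd_eq_add, Prod.fst_add, Prod.fst_neg]
        abel
      · simp only [vadd_eq_add, Prod.snd_add, Prod.snd_neg]
        linarith [hs i j]
    rw [this, AffineEquiv.map_vadd, map_neg, vadd_eq_add, sub_neg_eq_add]
  refine ⟨fun i => -(Φ.linear (a i, c i)), fun j => -Φ (x j, s j), fun i k hik => ?_,
    fun j k hjk => ?_, fun i j => ⟨fun hij => ?_, hgauge i j⟩⟩
  · exact ha (congrArg Prod.fst (Φ.linear.injective (neg_injective hik)))
  · exact hx (congrArg Prod.fst (Φ.injective (neg_injective hjk)))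
  · have := hgauge i j
    rw [sub_eq_zero.2 hij, gauge_zero] at this
    exact zero_ne_one this

/-- Let d ≥ 3 and n ≥ 1. Let χ : ℝ^{d−1} → [0,1] be C^∞ with χ(x) = 1 for
‖x‖₂ ≤ 1 and χ(x) = 0 for ‖x‖₂ ≥ 2, and let h > 0 be such that
ρ(x) = x₁² + ⋯ + x_{d−1}² + h·χ(x)·cos(πn·x₁) is convex on ℝ^{d−1}. Define
Σ₀ = {(x; ρ(x)) : ‖x‖₂ ≤ 4}. Suppose B₀ ⊆ ℝ^d is a unit ball such that ∂B₀ contains T(Σ₀)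
for some invertible affine transformation T. Then there exists ε > 0 such that for every
unit ball B with d_H(B₀, B) < ε, the unit distance graph of ‖·‖_B contains a copy of
K_{d, 2n}. -/
theorem stmt13 (d n : ℕ) (hd : 3 ≤ d) (hn : 1 ≤ n)
    (χ : EuclideanSpace ℝ (Fin (d - 1)) → ℝ)
    (hχsmooth : ContDiff ℝ (⊤ : ℕ∞) χ)
    (hχ01 : ∀ x, χ x ∈ Set.Icc (0 : ℝ) 1)
    (hχ1 : ∀ x, ‖x‖ ≤ 1 → χ x = 1)
    (hχ0 : ∀ x, 2 ≤ ‖x‖ → χ x = 0)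
    (h : ℝ) (hh : 0 < h)
    (ρ : EuclideanSpace ℝ (Fin (d - 1)) → ℝ)
    (hρ : ρ = fun x => (∑ i, x i ^ 2) +
      h * χ x * Real.cos (Real.pi * (n : ℝ) * x ⟨0, by omega⟩))
    (hρconv : ConvexOn ℝ Set.univ ρ)
    (B₀ : Set (EuclideanSpace ℝ (Fin d))) (hB₀ : IsUnitBall B₀)
    (T : EuclideanSpace ℝ (Fin d) ≃ᵃ[ℝ] EuclideanSpace ℝ (Fin d))
    (hT : ⇑T '' {p : EuclideanSpace ℝ (Fin d) |
        ∃ x : EuclideanSpace ℝ (Fin (d - 1)), ‖x‖ ≤ 4 ∧ p = toE d x (ρ x)} ⊆ frontier B₀) :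
    ∃ ε > (0 : ℝ), ∀ B : Set (EuclideanSpace ℝ (Fin d)), IsUnitBall B →
      Metric.hausdorffDist B₀ B < ε → ContainsK (gauge B) d (2 * n) := by
  obtain ⟨hB₀c, hB₀conv, -, -⟩ := hB₀
  set i₀ : Fin (d - 1) := ⟨0, by omega⟩ with hi₀
  set i₁ : Fin (d - 1) := ⟨1, by omega⟩ with hi₁
  have hi : i₁ ≠ i₀ := by simp [hi₀, hi₁]
  have : Nonempty (Fin (d - 1)) := ⟨i₀⟩
  have hn0 : (0 : ℝ) < n := by exact_mod_cast hn
  have hin : ∀ x, ‖x‖ ≤ 1 → ρ x = ‖x‖ ^ 2 + h * Real.cos (Real.pi * n * x i₀) := by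
    intro x hx
    rw [hρ, EuclideanSpace.real_norm_sq_eq]
    simp only [hχ1 x hx, mul_one]
  have hout : ∀ x, 2 ≤ ‖x‖ → ρ x = ‖x‖ ^ 2 := by
    intro x hx
    rw [hρ, EuclideanSpace.real_norm_sq_eq]
    simp [hχ0 x hx]
  have hρc : Continuous ρ := by
    have := hχsmooth.continuous
    rw [hρ]
    fun_prop
  set Φ := (toELinearEquiv d (by omega)).toAffineEquiv.trans T
  have hgraph : ∀ x, ‖x‖ ≤ 4 → Φ (x, ρ x) ∈ frontier B₀ := fun x hx =>
    hT ⟨toE d x (ρ x), ⟨x, hx, rfl⟩, rfl⟩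
  set t : Fin (2 * n) → ℝ := fun j => ((j : ℝ) + 1 / 2) / n - 1 with ht
  have htabs : ∀ j, |t j| < 1 := by
    intro j
    have hj : (j : ℝ) + 1 ≤ 2 * n := by exact_mod_cast j.2
    have h0 : (0 : ℝ) ≤ j := by positivity
    have h1 : ((j : ℝ) + 1 / 2) / n < 2 := by
      rw [div_lt_iff₀ hn0]
      linarith
    have h2 : 0 < ((j : ℝ) + 1 / 2) / n := by positivity
    rw [abs_lt]
    constructor <;> simp only [ht] <;> linarith
  have htcos : ∀ j, Real.cos (Real.pi * n * t j) = 0 := by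
    intro j
    rw [Real.cos_eq_zero_iff]
    refine ⟨(j : ℤ) - n, ?_⟩
    simp only [ht]
    push_cast
    field_simp
    ring
  have hev : ∀ᶠ δ in 𝓝[>] (0 : ℝ), ∀ j, _ := eventually_all.2 fun j =>
    eventually_exists_common_value hn hi hh hin hout (htabs j) (htcos j)
      (show 0 < 1 / (4 * (n : ℝ)) by positivity)
  have hlt1 : ∀ᶠ δ in 𝓝[>] (0 : ℝ), δ < 1 := nhdsWithin_le_nhds (Iio_mem_nhds one_pos)
  obtain ⟨δ, hδ, hδ1, hδ0⟩ := (hev.and (hlt1.and self_mem_nhdsWithin)).exists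
  obtain ⟨ε, hε, hclose⟩ := exists_close_graph_subset_frontier Φ hB₀c hB₀conv hρc hρconv hout
    hgraph hδ0 hδ1
  refine ⟨ε, hε, fun B hB hdist => ?_⟩
  obtain ⟨g, hg, hgρ, hgB⟩ := hclose B hB.1 ⟨0, mem_of_mem_nhds hB.2.2.2⟩ hB.2.1 hdist
  choose x hxt hx3 hx using fun j => hδ j g hg hgρ
  have hxinj : Function.Injective x := by
    intro j k hjk
    have hd1 : dist (EuclideanSpace.single i₀ (t j)) (EuclideanSpace.single i₀ (t k)) ≤
        1 / (2 * (n : ℝ)) := by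
      calc _ ≤ dist (x j) (EuclideanSpace.single i₀ (t j)) +
            dist (x j) (EuclideanSpace.single i₀ (t k)) := dist_triangle_left _ _ _
        _ ≤ 1 / (4 * (n : ℝ)) + 1 / (4 * (n : ℝ)) := by
          have := hxt k
          rw [← hjk] at this
          exact add_le_add (hxt j) this
        _ = _ := by field_simp; norm_num
    rw [PiLp.dist_single_same, Real.dist_eq] at hd1
    have hd2 : t j - t k = ((j : ℝ) - k) / n := by
      simp only [ht]
      ring
    rw [hd2, abs_div, abs_of_pos hn0, div_le_div_iff₀ hn0 (by positivity)] at hd1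
    have hd3 : |((j : ℤ) - k : ℤ)| < 1 := by
      have : |((j : ℝ) - k)| < 1 := by nlinarith
      exact_mod_cast this
    rw [Int.abs_lt_one_iff] at hd3
    exact Fin.ext (by omega)
  set e : Fin d ≃ Option (Fin (d - 1)) :=
    Fintype.equivOfCardEq (by simp; omega)
  have hainj : Function.Injective fun o : Option (Fin (d - 1)) =>
      o.elim 0 (translationVector i₀ i₁) := by
    rintro (_ | i) (_ | k) hik
    · rfl
    · exact absurd hik.symm (translationVector_ne_zero i₀ i₁ k)
    · exact absurd hik (translationVector_ne_zero i₀ i₁ i)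
    · exact congrArg some (translationVector_injective i₀ i₁ hik)
  refine containsK_gauge_of_common_value Φ hB (g := g)
    (c := fun i => (e i).elim 0 fun _ => -(25 / 4))
    (hainj.comp e.injective) hxinj (s := fun j => g (x j)) (fun i j => ?_) fun i j => hgB _ ?_
  · simp only [Function.comp_apply]
    rcases e i with _ | k
    · simp
    · exact (hx j k).2
  · simp only [Function.comp_apply]
    rcases e i with _ | k
    · simpa using hx3 j
    · exact (hx j k).1
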